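/- Assume the Continuum Hypothesis (𝔠 = ℵ₁). Let s : ℕ → ℕ be the successor map s(n) = n+1, which induces a homeomorphism s* of ℕ*. Then the inverse (s*)⁻¹ is a quotient of s*: there exists a continuous surjection Q : ℕ* → ℕ* such that Q ∘ s* = (s*)⁻¹ ∘ Q. -/

import Mathlib

open Filter Topology

/-- The space of free (non-principal) ultrafilters on `D`, with the subspace
topology inherited from the space of all ultrafilters on `D`. -/
abbrev FreeUF (D : Type*) := {U : Ultrafilter D // (U : Filter D) ≤ Filter.cofinite}

lemma finiteToOne_of_injective {D E : Type*} {f : D → E} (hf : Function.Injective f) (e : E) :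
    (f ⁻¹' {e}).Finite := by
  apply Set.Subsingleton.finite
  intro a ha b hb
  simp only [Set.mem_preimage, Set.mem_singleton_iff] at ha hb
  exact hf (ha.trans hb.symm)

lemma map_le_cofinite {D : Type*} {f : D → D} (hf : ∀ d : D, (f ⁻¹' {d}).Finite)
    {U : Ultrafilter D} (hU : (U : Filter D) ≤ Filter.cofinite) :
    (Ultrafilter.map f U : Filter D) ≤ Filter.cofinite := by
  rw [Filter.le_cofinite_iff_compl_singleton_mem]
  intro x
  have h1 : (f ⁻¹' {x})ᶜ ∈ (U : Filter D) := hU ((hf x).compl_mem_cofinite)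
  rw [Ultrafilter.coe_map, Filter.mem_map]
  simpa [Set.preimage_compl] using h1

/-- The trivial map `f*` on free ultrafilters induced by a finite-to-one map `f`,
sending an ultrafilter to its pushforward. -/
def ufMap {D : Type*} (f : D → D) (hf : ∀ d : D, (f ⁻¹' {d}).Finite) (U : FreeUF D) :
    FreeUF D :=
  ⟨Ultrafilter.map f U.1, map_le_cofinite hf U.2⟩

/-- `X` has weight at most `c`: it has a topological basis of cardinality at most `c`. -/
def HasWeightLE (X : Type) [TopologicalSpace X] (c : Cardinal) : Prop :=
  ∃ B : Set (Set X), TopologicalSpace.IsTopologicalBasis B ∧ Cardinal.mk B ≤ c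

lemma succ_injective' : Function.Injective (fun n : ℕ => n + 1) :=
  fun _ _ h => Nat.succ_injective h

/-- The shift map `s*` on `ℕ*`, induced by `s(n) = n + 1`. -/
noncomputable def sStar : FreeUF ℕ → FreeUF ℕ :=
  ufMap (fun n : ℕ => n + 1) (finiteToOne_of_injective succ_injective')

open scoped Nat

section ShiftTypes

/-- The edges and the base vertex of the finite digraph that a tuple of sets of naturals induces
on the cells of the partition it generates: an edge is a pair of cells containing consecutive
naturals infinitely often, and the base vertex is the cell belonging to `U`. -/
def shiftType (U : Ultrafilter ℕ) {n : ℕ} (t : Fin n → Set ℕ) :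
    Set ((Fin n → Prop) × (Fin n → Prop)) × Set (Fin n) :=
  ({q | ∃ᶠ m in atTop, ((fun i => m ∈ t i, fun i => m + 1 ∈ t i) : _ × _) = q}, {i | t i ∈ U})

lemma eventually_frequently_eq {α : Type*} [Finite α] (f : ℕ → α) :
    ∀ᶠ m in atTop, ∃ᶠ m' in atTop, f m' = f m := by
  have h : ∀ a : α, ∀ᶠ m in atTop, f m = a → ∃ᶠ m' in atTop, f m' = a := by
    intro a
    by_cases ha : ∃ᶠ m' in atTop, f m' = a
    · exact Eventually.of_forall fun _ _ => ha
    · filter_upwards [not_frequently.1 ha] with m hm h using absurd h hm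
  filter_upwards [eventually_all.2 h] with m hm using hm _ rfl

lemma eventually_frequently_of_shiftType_eq {U : Ultrafilter ℕ} {n : ℕ} {t t' : Fin n → Set ℕ}
    (h : shiftType U t = shiftType U t') :
    ∀ᶠ m in atTop, ∃ᶠ m' in atTop, ∀ i,
      (m ∈ t i ↔ m' ∈ t' i) ∧ (m + 1 ∈ t i ↔ m' + 1 ∈ t' i) := by
  filter_upwards [eventually_frequently_eq fun m =>
    ((fun i => m ∈ t i, fun i => m + 1 ∈ t i) : (Fin n → Prop) × (Fin n → Prop))] with m hm
  have h1 : ((fun i => m ∈ t i, fun i => m + 1 ∈ t i) : (Fin n → Prop) × (Fin n → Prop)) ∈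
      (shiftType U t').1 := h ▸ hm
  refine Frequently.mono h1 fun m' hm' i => ?_
  simp only [Prod.mk.injEq] at hm'
  exact ⟨(iff_of_eq (congrFun hm'.1 i)).symm, (iff_of_eq (congrFun hm'.2 i)).symm⟩

open Classical in
/-- A tuple of the given shift type which agrees with `p` on `I`, if there is one. -/
noncomputable def typeWitness (U : Ultrafilter ℕ) {n : ℕ} (I : Set (Fin n))
    (τ : Set ((Fin n → Prop) × (Fin n → Prop)) × Set (Fin n)) (p : Fin n → Set ℕ) :
    Fin n → Set ℕ :=
  if h : ∃ t : Fin n → Set ℕ, (∀ i ∈ I, t i = p i) ∧ shiftType U t = τ then h.choose else p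

lemma typeWitness_spec {U : Ultrafilter ℕ} {n : ℕ} {I : Set (Fin n)} {p t : Fin n → Set ℕ}
    (h : ∀ i ∈ I, t i = p i) :
    (∀ i ∈ I, typeWitness U I (shiftType U t) p i = p i) ∧
      shiftType U (typeWitness U I (shiftType U t) p) = shiftType U t := by
  have h' : ∃ t' : Fin n → Set ℕ, (∀ i ∈ I, t' i = p i) ∧ shiftType U t' = shiftType U t :=
    ⟨t, h, rfl⟩
  rw [typeWitness, dif_pos h']
  exact h'.choose_spec

/-- The closure of a family of sets under `typeWitness`. -/
inductive SkolemHull (U : Ultrafilter ℕ) (I : Set (Set ℕ)) : Set ℕ → Prop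
  | base {A : Set ℕ} (hA : A ∈ I) : SkolemHull U I A
  | step {n : ℕ} (K : Set (Fin n)) (τ : Set ((Fin n → Prop) × (Fin n → Prop)) × Set (Fin n))
      (p : Fin n → Set ℕ) (hp : ∀ i, SkolemHull U I (p i)) (i : Fin n) :
      SkolemHull U I (typeWitness U K τ p i)

/-- `SkolemHull` as a family of sets. -/
def skolemHull (U : Ultrafilter ℕ) (I : Set (Set ℕ)) : Set (Set ℕ) := {A | SkolemHull U I A}

variable {U : Ultrafilter ℕ}

lemma skolemHull_mono {I K : Set (Set ℕ)} (h : I ⊆ K) : skolemHull U I ⊆ skolemHull U K := by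
  intro A hA
  induction hA with
  | base hA => exact .base (h hA)
  | step L τ p _ i ih => exact SkolemHull.step L τ p ih i

lemma subset_skolemHull (I : Set (Set ℕ)) : I ⊆ skolemHull U I := fun _ hA => .base hA

lemma exists_mem_skolemHull_of_sUnion {C : Set (Set (Set ℕ))} (hC : DirectedOn (· ⊆ ·) C)
    (hne : C.Nonempty) {A : Set ℕ} (hA : A ∈ skolemHull U (⋃₀ C)) :
    ∃ I ∈ C, A ∈ skolemHull U I := by
  induction hA with
  | base hA =>
    obtain ⟨I, hI, hA⟩ := hA
    exact ⟨I, hI, .base hA⟩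
  | @step n L τ p _ i ih =>
    choose I hI hp using ih
    obtain ⟨K, hK, hIK⟩ : ∃ K ∈ C, ∀ i, I i ⊆ K := by
      have := hne.to_subtype
      obtain ⟨K, hK⟩ := hC.directed_val.finite_le fun i => ⟨I i, hI i⟩
      exact ⟨K, K.2, hK⟩
    exact ⟨K, hK, SkolemHull.step L τ p (fun j => skolemHull_mono (hIK j) (hp j)) i⟩

lemma countable_skolemHull {I : Set (Set ℕ)} (hI : I.Countable) :
    (skolemHull U I).Countable := by
  let next : Set (Set ℕ) → Set (Set ℕ) := fun T =>
    T ∪ ⋃ (n : ℕ) (K : Set (Fin n))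
      (τ : Set ((Fin n → Prop) × (Fin n → Prop)) × Set (Fin n)) (i : Fin n),
        (fun p => typeWitness U K τ p i) '' {p : Fin n → Set ℕ | ∀ i, p i ∈ T}
  let T : ℕ → Set (Set ℕ) := fun k => next^[k] I
  have hT : ∀ k, T (k + 1) = next (T k) := fun k => Function.iterate_succ_apply' next k I
  have hmono : Monotone T := monotone_nat_of_le_succ fun k => by
    rw [hT]; exact Set.subset_union_left
  have hcount : ∀ k, (T k).Countable := by
    intro k
    induction k with
    | zero => exact hI
    | succ k ih =>
      rw [hT]
      refine ih.union (Set.countable_iUnion fun n => Set.countable_iUnion fun K =>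
        Set.countable_iUnion fun τ => Set.countable_iUnion fun i => ?_)
      exact (Set.countable_pi fun _ => ih).image _
  refine (Set.countable_iUnion hcount).mono fun A hA => ?_
  induction hA with
  | base hA => exact Set.mem_iUnion.2 ⟨0, hA⟩
  | @step n K τ p _ i ih =>
    choose k hk using fun i => Set.mem_iUnion.1 (ih i)
    refine Set.mem_iUnion.2 ⟨Finset.univ.sup k + 1, ?_⟩
    rw [hT]
    refine Or.inr ?_
    simp only [Set.mem_iUnion]
    exact ⟨n, K, τ, i, p, fun j => hmono (Finset.le_sup (Finset.mem_univ j)) (hk j), rfl⟩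

/-- Every finite family of sets can be copied into a nonempty Skolem hull, fixing its members that
are already there and preserving the shift type. -/
lemma exists_copy_mem_skolemHull {I : Set (Set ℕ)} (hne : (skolemHull U I).Nonempty)
    (R : Finset (Set ℕ)) :
    ∃ g : Set ℕ → Set ℕ, (∀ A ∈ skolemHull U I, g A = A) ∧ (∀ A ∈ R, g A ∈ skolemHull U I) ∧
      (∀ A ∈ R, g A ∈ U ↔ A ∈ U) ∧
      (∀ᶠ m in atTop, ∃ᶠ m' in atTop, ∀ A ∈ R,
        (m ∈ g A ↔ m' ∈ A) ∧ (m + 1 ∈ g A ↔ m' + 1 ∈ A)) ∧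
      ∀ A ∈ R, A.Infinite → (g A).Infinite := by
  classical
  obtain ⟨B, hB⟩ := hne
  let t : Fin R.card → Set ℕ := fun i => (R.equivFin.symm i : Set ℕ)
  let K : Set (Fin R.card) := {i | t i ∈ skolemHull U I}
  let p : Fin R.card → Set ℕ := fun i => if i ∈ K then t i else B
  have htp : ∀ i ∈ K, t i = p i := fun i hi => (if_pos hi).symm
  have hp : ∀ i, p i ∈ skolemHull U I := by
    intro i
    by_cases hi : i ∈ K
    · rw [← htp i hi]; exact hi
    · simpa [p, hi] using hB
  obtain ⟨hwK, hw⟩ := typeWitness_spec (U := U) htp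
  set w := typeWitness U K (shiftType U t) p
  have hwmem : ∀ i, w i ∈ skolemHull U I := fun i => SkolemHull.step K _ p hp i
  let g : Set ℕ → Set ℕ := fun A =>
    if A ∈ skolemHull U I then A else if h : A ∈ R then w (R.equivFin ⟨A, h⟩) else A
  have ht : ∀ A (h : A ∈ R), t (R.equivFin ⟨A, h⟩) = A := fun A h => by simp [t]
  have hg : ∀ A (h : A ∈ R), g A = w (R.equivFin ⟨A, h⟩) := by
    intro A h
    by_cases hA : A ∈ skolemHull U I
    · have hK : R.equivFin ⟨A, h⟩ ∈ K := by simpa [K, ht A h] using hA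
      rw [hwK _ hK, ← htp _ hK, ht A h]
      simp [g, hA]
    · simp [g, hA, h]
  refine ⟨g, fun A hA => by simp [g, hA], fun A hA => hg A hA ▸ hwmem _, fun A hA => ?_, ?_,
    fun A hA hinf => ?_⟩
  · have := Set.ext_iff.1 (congrArg Prod.snd hw) (R.equivFin ⟨A, hA⟩)
    simpa [shiftType, ht A hA, hg A hA] using this
  · filter_upwards [eventually_frequently_of_shiftType_eq hw] with m hm
    refine hm.mono fun m' hm' A hA => ?_
    simpa only [ht A hA, hg A hA] using hm' (R.equivFin ⟨A, hA⟩)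
  · refine Nat.frequently_atTop_iff_infinite.1 ?_
    obtain ⟨m, hm, h⟩ := ((Nat.frequently_atTop_iff_infinite.2 hinf).and_eventually
      (eventually_frequently_of_shiftType_eq hw.symm)).exists
    refine h.mono fun m' hm' => ?_
    have := (hm' (R.equivFin ⟨A, hA⟩)).1
    rw [ht A hA, ← hg A hA] at this
    exact this.1 hm

end ShiftTypes

section PartialEmbeddings

/-- `Φ` restricted to `S` behaves like an embedding of `P(ℕ)/fin` with the shift into `P(ℕ)/fin`
with the inverse shift, sending members of `U` to sets containing almost all factorials. -/
structure IsReversingOn (U : Ultrafilter ℕ) (S : Set (Set ℕ)) (Φ : Set ℕ → Set ℕ) : Prop where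
  walk : ∀ R : Finset (Set ℕ), ↑R ⊆ S → ∀ᶠ n in atTop, ∃ᶠ m in atTop, ∀ A ∈ R,
    (n ∈ Φ A ↔ m + 1 ∈ A) ∧ (n + 1 ∈ Φ A ↔ m ∈ A)
  infinite : ∀ A ∈ S, A.Infinite → (Φ A).Infinite
  factorial_mem : ∀ A ∈ S, ∀ᶠ k in atTop, (k ! ∈ Φ A ↔ A ∈ U)

variable {U : Ultrafilter ℕ}

lemma IsReversingOn.comp {S : Set (Set ℕ)} {Φ : Set ℕ → Set ℕ} (hΦ : IsReversingOn U S Φ)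
    {R : Finset (Set ℕ)} {g : Set ℕ → Set ℕ} (hgS : ∀ A ∈ R, g A ∈ S)
    (hgU : ∀ A ∈ R, g A ∈ U ↔ A ∈ U)
    (hg : ∀ᶠ m in atTop, ∃ᶠ m' in atTop, ∀ A ∈ R,
        (m ∈ g A ↔ m' ∈ A) ∧ (m + 1 ∈ g A ↔ m' + 1 ∈ A))
    (hinf : ∀ A ∈ R, A.Infinite → (g A).Infinite) :
    IsReversingOn U R (Φ ∘ g) := by
  classical
  refine ⟨fun R' hR' => ?_, fun A hA h => hΦ.infinite _ (hgS A hA) (hinf A hA h), fun A hA => ?_⟩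
  · have hsub : ((R.image g : Finset (Set ℕ)) : Set (Set ℕ)) ⊆ S := by
      intro B hB
      obtain ⟨A, hA, rfl⟩ := Finset.mem_image.1 (Finset.mem_coe.1 hB)
      exact hgS A hA
    filter_upwards [hΦ.walk _ hsub] with n hn
    obtain ⟨m, hm, h⟩ := (hn.and_eventually hg).exists
    refine h.mono fun m' hm' A hA => ?_
    have h1 := hm _ (Finset.mem_image_of_mem g (hR' hA))
    have h2 := hm' A (hR' hA)
    exact ⟨h1.1.trans h2.2, h1.2.trans h2.1⟩
  · filter_upwards [hΦ.factorial_mem _ (hgS A hA)] with k hk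
    exact hk.trans (hgU A hA)

/-- A finite family of sets is reversed by walking periodically down an interval whose endpoints
lie in the cell belonging to `U`. -/
lemma exists_isReversingOn_finset (hU : (U : Filter ℕ) ≤ cofinite) (R : Finset (Set ℕ)) :
    ∃ Φ, IsReversingOn U R Φ := by
  classical
  let c : ℕ → R → Prop := fun m A => m ∈ (A : Set ℕ)
  obtain ⟨T, hT⟩ := eventually_atTop.1 (eventually_frequently_eq fun m => (c m, c (m + 1)))
  have hcell : ∃ᶠ m in atTop, ∀ A ∈ R, m ∈ A ↔ A ∈ U := by
    have h1 : ∀ᶠ m in (U : Filter ℕ), ∀ A ∈ R, m ∈ A ↔ A ∈ U := by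
      rw [Filter.eventually_all_finset]
      intro A _
      by_cases hA : A ∈ U
      · filter_upwards [hA] with m hm using iff_of_true hm hA
      · filter_upwards [Ultrafilter.compl_mem_iff_notMem.2 hA] with m hm using iff_of_false hm hA
    exact h1.frequently.filter_mono (Nat.cofinite_eq_atTop ▸ hU)
  obtain ⟨a, haT, ha⟩ := frequently_atTop.1 hcell T
  have hmeet : ∀ᶠ b in atTop, ∀ A ∈ R, A.Infinite → ∃ m ∈ A, a < m ∧ m ≤ b := by
    rw [Filter.eventually_all_finset]
    intro A _
    by_cases hA : A.Infinite
    · obtain ⟨m, hm, ham⟩ := hA.exists_gt a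
      filter_upwards [eventually_ge_atTop m] with b hb _ using ⟨m, hm, ham, hb⟩
    · exact Eventually.of_forall fun _ h => absurd h hA
  obtain ⟨b, hb, hmeet, hab⟩ :=
    (hcell.and_eventually (hmeet.and (eventually_gt_atTop a))).exists
  let l := b - a
  have hl : 0 < l := Nat.sub_pos_of_lt hab
  refine ⟨fun A => {n | b - n % l ∈ A}, fun R' hR' => ?_, fun A hA hinf => ?_, fun A hA => ?_⟩
  · refine Eventually.of_forall fun n => ?_
    have hlt : n % l < l := Nat.mod_lt _ hl
    refine (hT (b - n % l - 1) (by omega)).mono fun m hm A hA => ?_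
    simp only [Prod.mk.injEq] at hm
    have h1 : m ∈ A ↔ b - n % l - 1 ∈ A := iff_of_eq (congrFun hm.1 ⟨A, hR' hA⟩)
    have h2 : m + 1 ∈ A ↔ b - n % l - 1 + 1 ∈ A := iff_of_eq (congrFun hm.2 ⟨A, hR' hA⟩)
    rw [h1, h2, show b - n % l - 1 + 1 = b - n % l by omega]
    refine ⟨Iff.rfl, ?_⟩
    simp only [Set.mem_ofPred_eq]
    have hmod : (n + 1) % l = (n % l + 1) % l := (Nat.mod_add_mod n l 1).symm
    by_cases h : n % l + 1 < l
    · rw [hmod, Nat.mod_eq_of_lt h, Nat.sub_sub]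
    · have h3 : (n + 1) % l = 0 := by
        rw [hmod, show n % l + 1 = l by omega, Nat.mod_self]
      rw [h3, Nat.sub_zero, show b - n % l - 1 = a by omega, hb A (hR' hA), ha A (hR' hA)]
  · obtain ⟨m, hm, ham, hmb⟩ := hmeet A hA hinf
    rw [← Nat.frequently_atTop_iff_infinite, frequently_atTop]
    intro N
    refine ⟨b - m + l * N, by nlinarith [Nat.zero_le (b - m)], ?_⟩
    have : (b - m + l * N) % l = b - m := by
      rw [Nat.add_mul_mod_self_left, Nat.mod_eq_of_lt (by omega)]
    simp only [this]
    rwa [Nat.sub_sub_self hmb]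
  · filter_upwards [eventually_ge_atTop l] with k hk
    simp only [Nat.mod_eq_zero_of_dvd (Nat.dvd_factorial hl hk), Nat.sub_zero]
    exact hb A hA

/-- Reversing maps for an increasing sequence of finite families can be glued at factorials. -/
lemma exists_isReversingOn_of_finset {S S' : Set (Set ℕ)} (hS' : S'.Countable)
    {Φ : Set ℕ → Set ℕ} (h : ∀ R : Finset (Set ℕ), ↑R ⊆ S' →
      ∃ ψ, IsReversingOn U R ψ ∧ ∀ A ∈ S, ψ A = Φ A) :
    ∃ Φ', IsReversingOn U S' Φ' ∧ ∀ A ∈ S, Φ' A = Φ A := by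
  classical
  rcases S'.eq_empty_or_nonempty with rfl | hne
  · obtain ⟨ψ, h1, h2⟩ := h ∅ (by simp)
    exact ⟨ψ, by simpa using h1, h2⟩
  obtain ⟨d, rfl⟩ := hS'.exists_eq_range hne
  let R : ℕ → Finset (Set ℕ) := fun k => (Finset.range k).image d
  have hR : ∀ {i k}, i < k → d i ∈ R k := fun hik =>
    Finset.mem_image_of_mem d (Finset.mem_range.2 hik)
  have hRsub : ∀ k, ((R k : Finset (Set ℕ)) : Set (Set ℕ)) ⊆ Set.range d := by
    intro k A hA
    obtain ⟨i, _, rfl⟩ := Finset.mem_image.1 (Finset.mem_coe.1 hA)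
    exact ⟨i, rfl⟩
  have hRmono : Monotone R := fun k l hkl =>
    Finset.image_subset_image (Finset.range_subset_range.2 hkl)
  choose ψ hψ hψS using fun k => h (R k) (hRsub k)
  have hthr : ∀ k, ∀ᶠ N in atTop, (∀ n ≥ N, ∃ᶠ m in atTop, ∀ A ∈ R k,
      (n ∈ ψ k A ↔ m + 1 ∈ A) ∧ (n + 1 ∈ ψ k A ↔ m ∈ A)) ∧
      ∀ q ≥ N, ∀ A ∈ R k, (q ! ∈ ψ k A ↔ A ∈ U) := by
    intro k
    have h2 : ∀ᶠ q in atTop, ∀ A ∈ R k, (q ! ∈ ψ k A ↔ A ∈ U) :=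
      (Filter.eventually_all_finset _).2 fun A hA => (hψ k).factorial_mem A hA
    have h1 : ∀ᶠ n in atTop, ∃ᶠ m in atTop, ∀ A ∈ R k,
        (n ∈ ψ k A ↔ m + 1 ∈ A) ∧ (n + 1 ∈ ψ k A ↔ m ∈ A) := (hψ k).walk (R k) subset_rfl
    exact (eventually_forall_ge_atTop.2 h1).and (eventually_forall_ge_atTop.2 h2)
  choose N hN using fun k => (hthr k).exists
  have hstep : ∀ k a, ∃ b, a < b ∧ N (k + 1) ≤ b ∧
      ∀ A ∈ R k, A.Infinite → ∃ n ∈ ψ k A, a ! ≤ n ∧ n < b ! := by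
    intro k a
    have h1 : ∀ᶠ b in atTop, ∀ A ∈ R k, A.Infinite → ∃ n ∈ ψ k A, a ! ≤ n ∧ n < b ! := by
      refine (Filter.eventually_all_finset _).2 fun A hA => ?_
      by_cases hinf : A.Infinite
      · obtain ⟨n, hn, han⟩ := ((hψ k).infinite A hA hinf).exists_gt (a !)
        filter_upwards [eventually_gt_atTop n] with b hb _ using
          ⟨n, hn, han.le, hb.trans_le (Nat.self_le_factorial b)⟩
      · exact Eventually.of_forall fun _ h => absurd h hinf
    obtain ⟨b, h1, h2, h3⟩ :=
      (h1.and ((eventually_gt_atTop a).and (eventually_ge_atTop (N (k + 1))))).exists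
    exact ⟨b, h2, h3, h1⟩
  choose next hlt hNnext hvisit using hstep
  let q : ℕ → ℕ := fun k => Nat.rec (N 0 + 1) next k
  have hq : ∀ k, q (k + 1) = next k (q k) := fun k => rfl
  have hqpos : ∀ k, 0 < q k := by
    rintro (_ | k)
    · exact Nat.succ_pos _
    · exact (Nat.zero_le _).trans_lt (hq k ▸ hlt k (q k))
  have hqN : ∀ k, N k ≤ q k := by
    rintro (_ | k)
    · exact Nat.le_succ _
    · exact hq k ▸ hNnext k (q k)
  have hqmono : StrictMono fun k => (q k)! := strictMono_nat_of_lt_succ fun k =>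
    (Nat.factorial_lt (hqpos k)).2 (hq k ▸ hlt k (q k))
  let stage : ℕ → ℕ := fun n => Nat.findGreatest (fun k => (q k)! ≤ n) n
  have hstage : ∀ {k n}, (q k)! ≤ n → n < (q (k + 1))! → stage n = k := by
    intro k n h1 h2
    refine le_antisymm ?_ (Nat.le_findGreatest ((hqmono.id_le k).trans h1) h1)
    by_contra hlt'
    have h3 : (q (stage n))! ≤ n := Nat.findGreatest_spec (P := fun k => (q k)! ≤ n)
      ((hqmono.id_le k).trans h1) h1
    exact absurd (h2.trans_le (hqmono.monotone (not_le.1 hlt'))) (not_lt.2 h3)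
  have hloc : ∀ {k n}, (q k)! ≤ n → ∃ l ≥ k, (q l)! ≤ n ∧ n < (q (l + 1))! := by
    intro k n hkn
    have hs : k ≤ stage n := Nat.le_findGreatest ((hqmono.id_le k).trans hkn) hkn
    have h3 : (q (stage n))! ≤ n := Nat.findGreatest_spec (P := fun k => (q k)! ≤ n)
      ((hqmono.id_le k).trans hkn) hkn
    refine ⟨stage n, hs, h3, ?_⟩
    by_contra h4
    have : stage n + 1 ≤ stage n := Nat.le_findGreatest
      ((hqmono.id_le _).trans (not_lt.1 h4)) (not_lt.1 h4)
    omega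
  have hself : ∀ m, m ≤ m ! := Nat.self_le_factorial
  refine ⟨fun A => {n | n ∈ ψ (stage n) A}, ⟨fun F hF => ?_, ?_, ?_⟩, fun A hA => ?_⟩
  · obtain ⟨k, hk⟩ : ∃ k, F ⊆ R k := by
      have : ∀ᶠ k in atTop, ∀ A ∈ F, A ∈ R k := by
        refine (Filter.eventually_all_finset _).2 fun A hA => ?_
        obtain ⟨i, rfl⟩ := hF hA
        filter_upwards [eventually_gt_atTop i] with k hk using hR hk
      exact this.exists
    filter_upwards [eventually_ge_atTop ((q k)!)] with n hn
    obtain ⟨l, hkl, h1, h2⟩ := hloc hn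
    refine ((hN l).1 n (((hqN l).trans (hself _)).trans h1)).mono fun m hm A hA => ?_
    have hAl : A ∈ R l := hRmono hkl (hk hA)
    have hmA := hm A hAl
    simp only [hstage h1 h2]
    refine ⟨hmA.1, ?_⟩
    rcases (Nat.succ_le_of_lt h2).lt_or_eq with h3 | h3
    · rw [hstage (h1.trans n.le_succ) h3]
      exact hmA.2
    · have h4 : stage (n + 1) = l + 1 :=
        hstage h3.symm.le (h3.trans_lt (hqmono (Nat.lt_succ_self (l + 1))))
      have h3' : n + 1 = (q (l + 1))! := h3
      rw [h4, ← hmA.2, h3', (hN (l + 1)).2 _ (hqN (l + 1)) A (hRmono l.le_succ hAl),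
        (hN l).2 _ ((hqN l).trans (hq l ▸ hlt l (q l)).le) A hAl]
  · rintro _ ⟨i, rfl⟩ hinf
    rw [← Nat.frequently_atTop_iff_infinite, frequently_atTop]
    intro M
    let k := max M (i + 1)
    obtain ⟨n, hn, h1, h2⟩ := hvisit k (q k) (d i) (hR (by omega)) hinf
    refine ⟨n, ((le_max_left M (i + 1)).trans (hqmono.id_le k)).trans h1, ?_⟩
    simpa only [Set.mem_ofPred_eq, hstage h1 (hq k ▸ h2)] using hn
  · rintro _ ⟨i, rfl⟩
    filter_upwards [eventually_ge_atTop (q (i + 1))] with r hr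
    obtain ⟨l, hl, h1, h2⟩ := hloc (k := i + 1) (n := r !) (Nat.factorial_le hr)
    simp only [hstage h1 h2]
    refine (hN l).2 r ?_ _ (hR (by omega))
    by_contra hlt'
    exact absurd h1 (not_le.2 ((Nat.factorial_lt ((hqpos (i + 1)).trans_le hr)).2
      ((not_le.1 hlt').trans_le (hqN l))))
  · ext n
    simp only [Set.mem_ofPred_eq, hψS _ A hA]

lemma exists_isReversingOn_extension (hU : (U : Filter ℕ) ≤ cofinite) {I I' : Set (Set ℕ)}
    (hI' : I'.Countable) {Φ : Set ℕ → Set ℕ} (hΦ : IsReversingOn U (skolemHull U I) Φ) :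
    ∃ Φ', IsReversingOn U (skolemHull U I') Φ' ∧ ∀ A ∈ skolemHull U I, Φ' A = Φ A := by
  refine exists_isReversingOn_of_finset (countable_skolemHull hI') fun R _ => ?_
  rcases (skolemHull U I).eq_empty_or_nonempty with he | hne
  · obtain ⟨ψ, hψ⟩ := exists_isReversingOn_finset hU R
    exact ⟨ψ, hψ, by simp [he]⟩
  · obtain ⟨g, hid, hgS, hgU, hg, hinf⟩ := exists_copy_mem_skolemHull hne R
    exact ⟨Φ ∘ g, hΦ.comp hgS hgU hg hinf, fun A hA => by simp [hid A hA]⟩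

lemma exists_wellOrder_countable (CH : Cardinal.continuum.{0} = Cardinal.aleph 1) :
    ∃ r : Set ℕ → Set ℕ → Prop, IsWellOrder (Set ℕ) r ∧ ∀ A, {B | r B A}.Countable := by
  obtain ⟨r, wo, hr⟩ := Cardinal.exists_ord_eq (Set ℕ)
  refine ⟨r, wo, fun A => ?_⟩
  have h : Cardinal.mk {B | r B A} < Cardinal.mk (Set ℕ) :=
    (Ordinal.card_typein A).symm.trans_lt (Cardinal.card_typein_lt A hr)
  rwa [Cardinal.mk_set, Cardinal.mk_nat, Cardinal.two_power_aleph0, CH, Cardinal.lt_aleph_one_iff,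
    Cardinal.le_aleph0_iff_set_countable] at h

/-- Under the continuum hypothesis there is a reversing map defined on all sets of naturals. -/
lemma exists_isReversingOn_univ (CH : Cardinal.continuum.{0} = Cardinal.aleph 1)
    (hU : (U : Filter ℕ) ≤ cofinite) : ∃ Φ, IsReversingOn U Set.univ Φ := by
  classical
  obtain ⟨r, wo, hr⟩ := exists_wellOrder_countable CH
  let P := {p : Set (Set ℕ) × (Set ℕ → Set ℕ) //
    (∀ A ∈ p.1, ∀ B, r B A → B ∈ p.1) ∧ IsReversingOn U (skolemHull U p.1) p.2}
  let le : P → P → Prop := fun p p' =>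
    p.1.1 ⊆ p'.1.1 ∧ ∀ A ∈ skolemHull U p.1.1, p'.1.2 A = p.1.2 A
  have hrefl : ∀ p, le p p := fun p => ⟨subset_rfl, fun _ _ => rfl⟩
  have hnil : IsReversingOn U (skolemHull U ∅) id := by
    have he : ∀ A, A ∉ skolemHull U ∅ := by
      intro A hA
      induction hA with
      | base hA => exact hA
      | step _ _ _ _ i ih => exact ih i
    exact ⟨fun R hR => by
      have : R = ∅ := Finset.eq_empty_of_forall_notMem fun A hA => he A (hR hA)
      subst this
      exact Eventually.of_forall fun _ => (Eventually.of_forall (by simp)).frequently,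
      fun A hA => absurd hA (he A), fun A hA => absurd hA (he A)⟩
  obtain ⟨p, hp⟩ : ∃ p, ∀ p', le p p' → le p' p := by
    refine exists_maximal_of_chains_bounded (fun c hc => ?_) fun {a b c} hab hbc =>
      ⟨hab.1.trans hbc.1, fun A hA => (hbc.2 A (skolemHull_mono hab.1 hA)).trans (hab.2 A hA)⟩
    rcases c.eq_empty_or_nonempty with rfl | ⟨p₀, hp₀⟩
    · exact ⟨⟨(∅, id), by simp, hnil⟩, by simp⟩
    have htot : ∀ p ∈ c, ∀ p' ∈ c, le p p' ∨ le p' p := by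
      intro p h p' h'
      by_cases e : p = p'
      · exact Or.inl (e ▸ hrefl p)
      · exact hc h h' e
    let C : Set (Set (Set ℕ)) := (fun p : P => p.1.1) '' c
    have hC : DirectedOn (· ⊆ ·) C := by
      rintro _ ⟨p, h, rfl⟩ _ ⟨p', h', rfl⟩
      rcases htot p h p' h' with hle | hle
      · exact ⟨_, ⟨p', h', rfl⟩, hle.1, subset_rfl⟩
      · exact ⟨_, ⟨p, h, rfl⟩, subset_rfl, hle.1⟩
    have hmem : ∀ {A}, A ∈ skolemHull U (⋃₀ C) → ∃ p ∈ c, A ∈ skolemHull U p.1.1 := by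
      intro A hA
      obtain ⟨_, ⟨p, h, rfl⟩, hA⟩ := exists_mem_skolemHull_of_sUnion hC ⟨_, p₀, hp₀, rfl⟩ hA
      exact ⟨p, h, hA⟩
    let Φ : Set ℕ → Set ℕ := fun A =>
      if h : ∃ p ∈ c, A ∈ skolemHull U p.1.1 then h.choose.1.2 A else A
    have hΦ : ∀ p ∈ c, ∀ A ∈ skolemHull U p.1.1, Φ A = p.1.2 A := by
      intro p h A hA
      have hex : ∃ p ∈ c, A ∈ skolemHull U p.1.1 := ⟨p, h, hA⟩
      simp only [Φ, dif_pos hex]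
      rcases htot p h _ hex.choose_spec.1 with hle | hle
      · exact hle.2 A hA
      · exact (hle.2 A hex.choose_spec.2).symm
    have hrev : IsReversingOn U (skolemHull U (⋃₀ C)) Φ := by
      refine ⟨fun R hR => ?_, fun A hA hinf => ?_, fun A hA => ?_⟩
      · obtain ⟨p, h, hRp⟩ : ∃ p ∈ c, ↑R ⊆ skolemHull U p.1.1 := by
          refine DirectedOn.exists_mem_subset_of_finset_subset_biUnion
            (f := fun p : P => skolemHull U p.1.1) ⟨p₀, hp₀⟩ (fun p h p' h' => ?_)
            fun A hA => ?_
          · rcases htot p h p' h' with hle | hle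
            · exact ⟨p', h', skolemHull_mono hle.1, subset_rfl⟩
            · exact ⟨p, h, subset_rfl, skolemHull_mono hle.1⟩
          · simpa using hmem (hR hA)
        filter_upwards [p.2.2.walk R hRp] with n hn
        refine hn.mono fun m hm A hA => ?_
        rw [hΦ p h A (hRp hA)]
        exact hm A hA
      · obtain ⟨p, h, hA⟩ := hmem hA
        rw [hΦ p h A hA]
        exact p.2.2.infinite A hA hinf
      · obtain ⟨p, h, hA⟩ := hmem hA
        rw [hΦ p h A hA]
        exact p.2.2.factorial_mem A hA
    refine ⟨⟨(⋃₀ C, Φ), ?_, hrev⟩, fun p h =>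
      ⟨Set.subset_sUnion_of_mem ⟨p, h, rfl⟩, hΦ p h⟩⟩
    rintro A ⟨_, ⟨p, h, rfl⟩, hA⟩ B hBA
    exact ⟨_, ⟨p, h, rfl⟩, p.2.1 A hA B hBA⟩
  have huniv : p.1.1 = Set.univ := by
    by_contra hne
    obtain ⟨A, hA⟩ := (Set.ne_univ_iff_exists_notMem _).1 hne
    let I' : Set (Set ℕ) := insert A {B | r B A}
    have hsub : p.1.1 ⊆ I' := by
      intro B hB
      rcases trichotomous_of r A B with h | rfl | h
      · exact absurd (p.2.1 B hB A h) hA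
      · exact absurd hB hA
      · exact Or.inr h
    obtain ⟨Φ', hΦ', hext⟩ := exists_isReversingOn_extension hU ((hr A).insert A) p.2.2
    have hlower : ∀ D ∈ I', ∀ B, r B D → B ∈ I' := by
      rintro D (rfl | hD) B hB
      · exact Or.inr hB
      · exact Or.inr (_root_.trans hB hD)
    exact hA ((hp ⟨(I', Φ'), hlower, hΦ'⟩ ⟨hsub, hext⟩).1 (Set.mem_insert A _))
  have hall : skolemHull U p.1.1 = Set.univ :=
    Set.eq_univ_of_univ_subset (huniv ▸ subset_skolemHull p.1.1)
  exact ⟨p.1.2, hall ▸ p.2.2⟩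

end PartialEmbeddings

section Quotient

variable {U : Ultrafilter ℕ} {Φ : Set ℕ → Set ℕ}

lemma IsReversingOn.eventually_exists (hΦ : IsReversingOn U Set.univ Φ) (R : Finset (Set ℕ))
    (N : ℕ) : ∀ᶠ n in atTop, ∃ m ≥ N, ∀ A ∈ R,
      (n ∈ Φ A ↔ m + 1 ∈ A) ∧ (n + 1 ∈ Φ A ↔ m ∈ A) := by
  filter_upwards [hΦ.walk R (Set.subset_univ _)] with n hn using frequently_atTop.1 hn N

lemma IsReversingOn.eventually_notMem (hΦ : IsReversingOn U Set.univ Φ) {A : Set ℕ}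
    (hA : A.Finite) : ∀ᶠ n in atTop, n ∉ Φ A := by
  obtain ⟨N, hN⟩ := hA.bddAbove
  filter_upwards [hΦ.eventually_exists {A} N] with n hn h
  obtain ⟨m, hm, hmA⟩ := hn
  have := hN (((hmA A (by simp)).1).1 h)
  omega

lemma IsReversingOn.eventually_compl (hΦ : IsReversingOn U Set.univ Φ) (A : Set ℕ) :
    ∀ᶠ n in atTop, (n ∈ Φ Aᶜ ↔ n ∉ Φ A) := by
  classical
  filter_upwards [hΦ.eventually_exists {A, Aᶜ} 0] with n hn
  obtain ⟨m, -, hm⟩ := hn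
  rw [(hm A (by simp)).1, (hm Aᶜ (by simp)).1, Set.mem_compl_iff]

lemma IsReversingOn.eventually_inter (hΦ : IsReversingOn U Set.univ Φ) (A B : Set ℕ) :
    ∀ᶠ n in atTop, (n ∈ Φ (A ∩ B) ↔ n ∈ Φ A ∧ n ∈ Φ B) := by
  classical
  filter_upwards [hΦ.eventually_exists {A, B, A ∩ B} 0] with n hn
  obtain ⟨m, -, hm⟩ := hn
  rw [(hm A (by simp)).1, (hm B (by simp)).1, (hm (A ∩ B) (by simp)).1, Set.mem_inter_iff]

lemma IsReversingOn.eventually_shift (hΦ : IsReversingOn U Set.univ Φ) (A : Set ℕ) :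
    ∀ᶠ n in atTop, (n + 1 ∈ Φ ((fun n => n + 1) ⁻¹' A) ↔ n ∈ Φ A) := by
  classical
  filter_upwards [hΦ.eventually_exists {A, (fun n => n + 1) ⁻¹' A} 0] with n hn
  obtain ⟨m, -, hm⟩ := hn
  rw [(hm A (by simp)).1, (hm ((fun n => n + 1) ⁻¹' A) (by simp)).2, Set.mem_preimage]

lemma FreeUF.mem_of_eventually (V : FreeUF ℕ) {p : ℕ → Prop} (h : ∀ᶠ n in atTop, p n) :
    ∀ᶠ n in (V.1 : Filter ℕ), p n :=
  V.2 (Nat.cofinite_eq_atTop ▸ h)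

lemma FreeUF.mem_congr (V : FreeUF ℕ) {A B : Set ℕ} (h : ∀ᶠ n in atTop, (n ∈ A ↔ n ∈ B)) :
    A ∈ V.1 ↔ B ∈ V.1 :=
  Filter.congr_sets (V.mem_of_eventually h)

/-- The self-map of `ℕ*` dual to a reversing map. -/
def IsReversingOn.dual (hΦ : IsReversingOn U Set.univ Φ) (V : FreeUF ℕ) : FreeUF ℕ :=
  have hinter : ∀ A B, Φ (A ∩ B) ∈ V.1 ↔ Φ A ∈ V.1 ∧ Φ B ∈ V.1 := fun A B => by
    rw [V.mem_congr (B := Φ A ∩ Φ B) (hΦ.eventually_inter A B)]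
    exact Filter.inter_mem_iff
  have hcompl : ∀ A, Φ Aᶜ ∈ V.1 ↔ Φ A ∉ V.1 := fun A => by
    rw [V.mem_congr (B := (Φ A)ᶜ) (hΦ.eventually_compl A), Ultrafilter.compl_mem_iff_notMem]
  have hfinite : ∀ A, A.Finite → Φ A ∉ V.1 := fun A hA => by
    rw [← Ultrafilter.compl_mem_iff_notMem]
    exact V.mem_of_eventually (hΦ.eventually_notMem hA)
  ⟨Ultrafilter.ofComplNotMemIff
    { sets := {A | Φ A ∈ V.1}
      univ_sets := by
        have := (hcompl ∅).2 (hfinite ∅ Set.finite_empty)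
        rwa [Set.compl_empty] at this
      sets_of_superset := fun {A B} hA hAB => by
        rw [← Set.inter_eq_left.2 hAB] at hA
        exact ((hinter A B).1 hA).2
      inter_sets := fun {A B} hA hB => (hinter A B).2 ⟨hA, hB⟩ }
    fun A => (hcompl A).not_left, fun A hA => by
      have := (hcompl Aᶜ).2 (hfinite Aᶜ hA)
      rwa [compl_compl] at this⟩

lemma IsReversingOn.mem_dual (hΦ : IsReversingOn U Set.univ Φ) {V : FreeUF ℕ} {A : Set ℕ} :
    A ∈ (hΦ.dual V).1 ↔ Φ A ∈ V.1 := Iff.rfl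

lemma IsReversingOn.continuous_dual (hΦ : IsReversingOn U Set.univ Φ) : Continuous hΦ.dual := by
  refine Continuous.subtype_mk (ultrafilterBasis_is_basis.continuous_iff.2 ?_) _
  rintro _ ⟨A, rfl⟩
  exact (ultrafilter_isOpen_basic (Φ A)).preimage continuous_subtype_val

lemma IsReversingOn.surjective_dual (hΦ : IsReversingOn U Set.univ Φ) :
    Function.Surjective hΦ.dual := by
  intro W
  let F : W.1.sets → Filter ℕ := fun A => atTop ⊓ 𝓟 (Φ A)
  have hF : ∀ A, (F A).NeBot := by
    refine fun A => frequently_mem_iff_neBot.1 (Nat.frequently_atTop_iff_infinite.2 ?_)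
    refine hΦ.infinite A (Set.mem_univ _) fun hA => ?_
    exact Ultrafilter.compl_notMem_iff.2 A.2 (W.2 hA.compl_mem_cofinite)
  have hle : ∀ A B : W.1.sets, (A : Set ℕ) ⊆ B → F A ≤ F B := by
    intro A B hAB
    refine le_inf inf_le_left (le_principal_iff.2 (mem_inf_principal.2 ?_))
    filter_upwards [hΦ.eventually_inter A B] with n hn hA
    rw [Set.inter_eq_left.2 hAB] at hn
    exact (hn.1 hA).2
  have hdir : Directed (· ≥ ·) F := fun A B =>
    ⟨⟨A ∩ B, inter_mem A.2 B.2⟩, hle _ _ Set.inter_subset_left, hle _ _ Set.inter_subset_right⟩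
  have : Nonempty W.1.sets := ⟨⟨Set.univ, univ_mem⟩⟩
  have := iInf_neBot_of_directed hdir hF
  have hof : ∀ A, (Ultrafilter.of (⨅ A, F A) : Filter ℕ) ≤ F A := fun A =>
    (Ultrafilter.of_le _).trans (iInf_le F A)
  refine ⟨⟨Ultrafilter.of (⨅ A, F A),
    ((hof ⟨Set.univ, univ_mem⟩).trans inf_le_left).trans_eq Nat.cofinite_eq_atTop.symm⟩, ?_⟩
  refine Subtype.ext (Ultrafilter.coe_le_coe.1 fun A hA => ?_)
  exact hof ⟨A, hA⟩ (mem_inf_of_right (mem_principal_self _))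

lemma IsReversingOn.sStar_dual_sStar (hΦ : IsReversingOn U Set.univ Φ) (V : FreeUF ℕ) :
    sStar (hΦ.dual (sStar V)) = hΦ.dual V :=
  Subtype.ext <| Ultrafilter.ext fun A => V.mem_congr (hΦ.eventually_shift A)

end Quotient

/-- Under CH, the inverse of the shift map `s*` is a quotient of `s*`: there is a continuous
surjection `Q : ℕ* → ℕ*` with `Q ∘ s* = (s*)⁻¹ ∘ Q` (equivalently, since `s*` is injective,
`s* ∘ Q ∘ s* = Q`). -/
theorem inverse_shift_quotient_of_shift (CH : Cardinal.continuum = Cardinal.aleph 1) :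
    ∃ Q : FreeUF ℕ → FreeUF ℕ, Continuous Q ∧ Function.Surjective Q ∧
      ∀ U : FreeUF ℕ, sStar (Q (sStar U)) = Q U := by
  obtain ⟨Φ, hΦ⟩ := exists_isReversingOn_univ
    (Cardinal.lift_injective (by simpa using CH))
    (hyperfilter_le_cofinite (α := ℕ))
  exact ⟨hΦ.dual, hΦ.continuous_dual, hΦ.surjective_dual, hΦ.sStar_dual_sStar⟩
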